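/- In a right-angled Artin group A(Γ), every nonidentity element can be written as a product W_n ⋯ W_1 of central words such that for each i, the last letter of W_i does not commute with the last letter of W_{i+1}. -/

import Mathlib

def raagRels {V : Type*} (Γ : SimpleGraph V) : Set (FreeGroup V) :=
  {r | ∃ a b : V, Γ.Adj a b ∧
    r = FreeGroup.of a * FreeGroup.of b * (FreeGroup.of a)⁻¹ * (FreeGroup.of b)⁻¹}

abbrev RAAG {V : Type*} (Γ : SimpleGraph V) : Type _ := PresentedGroup (raagRels Γ)

/-- Evaluation in `A(Γ)` of a word given as a list of (generator, exponent) pairs,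
written left to right. -/
def evalWord {V : Type*} (Γ : SimpleGraph V) (L : List (V × ℤ)) : RAAG Γ :=
  (L.map fun p => (PresentedGroup.of p.1 : RAAG Γ) ^ p.2).prod

/-- A central word: a nonempty word `γ_n^{k_n} ⋯ γ_1^{k_1}` with nonzero exponents whose
letters are pairwise distinct and pairwise commute (adjacent in `Γ`). -/
def IsCentralWord {V : Type*} (Γ : SimpleGraph V) (L : List (V × ℤ)) : Prop :=
  L ≠ [] ∧ (∀ p ∈ L, p.2 ≠ 0) ∧
    (L.map Prod.fst).Pairwise fun a b => a ≠ b ∧ Γ.Adj a b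

/-- The last letters of two blocks do not commute (are distinct and non-adjacent). -/
def LastLettersNonCommuting {V : Type*} (Γ : SimpleGraph V)
    (B B' : List (V × ℤ)) : Prop :=
  ∃ u v : V × ℤ, B.getLast? = some u ∧ B'.getLast? = some v ∧
    u.1 ≠ v.1 ∧ ¬ Γ.Adj u.1 v.1

/-- A possibly empty central word. -/
def IsCliqueWord {V : Type*} (Γ : SimpleGraph V) (L : List (V × ℤ)) : Prop :=
  (∀ p ∈ L, p.2 ≠ 0) ∧ L.Pairwise fun p q => Γ.Adj p.1 q.1

/-- Every letter of `C` fails to commute with some letter of `B`. -/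
def Blocks {V : Type*} (Γ : SimpleGraph V) (B C : List (V × ℤ)) : Prop :=
  ∀ p ∈ C, ∃ q ∈ B, q.1 ≠ p.1 ∧ ¬ Γ.Adj q.1 p.1

/-- Number of letters of a list of blocks, the `i`-th block counted with weight `2 ^ i`. -/
def blockWeight {V : Type*} : List (List (V × ℤ)) → ℕ
  | [] => 0
  | B :: L => B.length + 2 * blockWeight L

section

variable {V : Type*} {Γ : SimpleGraph V}

theorem commute_of_adj {a b : V} (h : Γ.Adj a b) :
    Commute (PresentedGroup.of a : RAAG Γ) (PresentedGroup.of b) := by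
  have h1 := PresentedGroup.one_of_mem (rels := raagRels Γ) ⟨a, b, h, rfl⟩
  rw [map_mul, map_mul, map_mul, map_inv, map_inv, mul_inv_eq_one, mul_inv_eq_iff_eq_mul] at h1
  exact h1

@[simp] theorem evalWord_nil : evalWord Γ [] = 1 := rfl

@[simp] theorem evalWord_cons (p : V × ℤ) (L : List (V × ℤ)) :
    evalWord Γ (p :: L) = (PresentedGroup.of p.1 : RAAG Γ) ^ p.2 * evalWord Γ L := by
  simp [evalWord]

theorem IsCliqueWord.isCentralWord {L : List (V × ℤ)} (h : IsCliqueWord Γ L) (hL : L ≠ []) :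
    IsCentralWord Γ L :=
  ⟨hL, h.1, List.pairwise_map.2 (h.2.imp fun h => ⟨h.ne, h⟩)⟩

theorem IsCliqueWord.perm {L M : List (V × ℤ)} (h : IsCliqueWord Γ L) (hLM : L.Perm M) :
    IsCliqueWord Γ M :=
  ⟨fun p hp => h.1 p (hLM.mem_iff.2 hp), h.2.perm hLM fun h => h.symm⟩

theorem IsCliqueWord.evalWord_perm {L M : List (V × ℤ)} (h : IsCliqueWord Γ L)
    (hLM : L.Perm M) : evalWord Γ L = evalWord Γ M :=
  (hLM.map _).prod_eq' (List.pairwise_map.2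
    (h.2.imp fun h => ((commute_of_adj h).zpow_zpow _ _)))

theorem IsCliqueWord.of_cons {p : V × ℤ} {L : List (V × ℤ)} (h : IsCliqueWord Γ (p :: L)) :
    IsCliqueWord Γ L :=
  ⟨fun q hq => h.1 q (List.mem_cons_of_mem _ hq), (List.pairwise_cons.1 h.2).2⟩

/-- A syllable commuting with every letter of a clique word can be absorbed into it. -/
theorem IsCliqueWord.exists_absorb {B : List (V × ℤ)} (hB : IsCliqueWord Γ B) {p : V × ℤ}
    (hp : p.2 ≠ 0) (hc : ∀ q ∈ B, q.1 ≠ p.1 → Γ.Adj q.1 p.1) :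
    ∃ B', IsCliqueWord Γ B' ∧ B'.length ≤ B.length + 1 ∧
      evalWord Γ B' = (PresentedGroup.of p.1 : RAAG Γ) ^ p.2 * evalWord Γ B ∧
      evalWord Γ B' = evalWord Γ B * (PresentedGroup.of p.1 : RAAG Γ) ^ p.2 := by
  have hcomm : Commute ((PresentedGroup.of p.1 : RAAG Γ) ^ p.2) (evalWord Γ B) := by
    refine Commute.list_prod_right _ _ fun x hx => ?_
    obtain ⟨q, hq, rfl⟩ := List.mem_map.1 hx
    by_cases hqp : q.1 = p.1
    · rw [hqp]
      exact (Commute.refl _).zpow_zpow _ _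
    · exact (commute_of_adj (hc q hq hqp).symm).zpow_zpow _ _
  suffices ∃ B', IsCliqueWord Γ B' ∧ B'.length ≤ B.length + 1 ∧
      evalWord Γ B' = (PresentedGroup.of p.1 : RAAG Γ) ^ p.2 * evalWord Γ B by
    obtain ⟨B', h1, h2, h3⟩ := this
    exact ⟨B', h1, h2, h3, h3.trans hcomm.eq⟩
  by_cases h : ∃ q ∈ B, q.1 = p.1
  · obtain ⟨q, hq, hqp⟩ := h
    obtain ⟨s, t, rfl⟩ := List.append_of_mem hq
    have hperm : (s ++ q :: t).Perm (q :: (s ++ t)) := List.perm_middle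
    have hclique := hB.perm hperm
    rw [hB.evalWord_perm hperm, evalWord_cons, hqp, ← mul_assoc, ← zpow_add, hperm.length_eq]
    by_cases h0 : p.2 + q.2 = 0
    · exact ⟨s ++ t, hclique.of_cons, by simp only [List.length_cons]; omega, by simp [h0]⟩
    · refine ⟨(p.1, p.2 + q.2) :: (s ++ t), ⟨?_, ?_⟩, by simp, by simp⟩
      · intro r hr
        rcases List.mem_cons.1 hr with rfl | hr
        · exact h0
        · exact hclique.of_cons.1 r hr
      · have := List.pairwise_cons.1 hclique.2
        rw [hqp] at this
        exact List.pairwise_cons.2 this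
  · push Not at h
    refine ⟨p :: B, ⟨?_, ?_⟩, by simp, by simp⟩
    · intro r hr
      rcases List.mem_cons.1 hr with rfl | hr
      · exact hp
      · exact hB.1 r hr
    · exact List.pairwise_cons.2 ⟨fun q hq => (hc q hq (h q hq)).symm, hB.2⟩

theorem exists_isChain_blocks (n : ℕ) : ∀ L : List (List (V × ℤ)), blockWeight L + L.length ≤ n →
    (∀ B ∈ L, IsCliqueWord Γ B) →
    ∃ M : List (List (V × ℤ)), blockWeight M ≤ blockWeight L ∧ M.length ≤ L.length ∧
      (∀ B ∈ M, IsCliqueWord Γ B) ∧ M.IsChain (Blocks Γ) ∧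
      (M.map (evalWord Γ)).prod = (L.map (evalWord Γ)).prod := by
  induction n with
  | zero =>
    intro L hL _
    obtain rfl : L = [] := List.length_eq_zero_iff.1 (by omega)
    exact ⟨[], by simp⟩
  | succ n ih =>
    rintro (_ | ⟨A, L⟩) hn hL
    · exact ⟨[], by simp⟩
    rw [List.forall_mem_cons] at hL
    simp only [blockWeight, List.length_cons] at hn
    obtain ⟨M, hw, hlen, hM, hchain, hprod⟩ := ih L (by omega) hL.2
    rcases M with _ | ⟨C, M⟩
    · exact ⟨[A], by simp [blockWeight], by simp, by simpa using hL.1, by simp,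
        by simp [← hprod]⟩
    by_cases hAC : Blocks Γ A C
    · refine ⟨A :: C :: M, by simp only [blockWeight] at hw ⊢; omega, by simpa using hlen,
        List.forall_mem_cons.2 ⟨hL.1, hM⟩, List.isChain_cons_cons.2 ⟨hAC, hchain⟩, ?_⟩
      rw [List.map_cons, List.prod_cons, hprod, List.map_cons, List.prod_cons]
    · unfold Blocks at hAC
      push Not at hAC
      obtain ⟨p, hp, hc⟩ := hAC
      rw [List.forall_mem_cons] at hM
      obtain ⟨s, t, rfl⟩ := List.append_of_mem hp
      have hperm : (s ++ p :: t).Perm (p :: (s ++ t)) := List.perm_middle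
      obtain ⟨A', hA', hlA, -, heval⟩ := hL.1.exists_absorb (hM.1.1 p hp) hc
      simp only [blockWeight, hperm.length_eq, List.length_cons] at hw hlen
      obtain ⟨N, hw', hlen', hN, hNchain, hNprod⟩ := ih (A' :: (s ++ t) :: M)
        (by simp only [blockWeight, List.length_cons]; omega)
        (List.forall_mem_cons.2 ⟨hA', List.forall_mem_cons.2
          ⟨(hM.1.perm hperm).of_cons, hM.2⟩⟩)
      simp only [blockWeight, List.length_cons] at hw' hlen'
      refine ⟨N, by simp only [blockWeight]; omega, by simp only [List.length_cons]; omega,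
        hN, hNchain, ?_⟩
      rw [hNprod, List.map_cons, List.prod_cons, List.map_cons, List.prod_cons, heval,
        List.map_cons, List.prod_cons, ← hprod, List.map_cons, List.prod_cons,
        hM.1.evalWord_perm hperm, evalWord_cons]
      simp only [mul_assoc]

theorem prod_eq_one_of_isChain_blocks_nil (L : List (List (V × ℤ)))
    (h : ([] :: L).IsChain (Blocks Γ)) : (L.map (evalWord Γ)).prod = 1 := by
  induction L with
  | nil => rfl
  | cons C L ih =>
    rw [List.isChain_cons_cons] at h
    obtain rfl : C = [] := List.eq_nil_iff_forall_not_mem.2 fun p hp => by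
      obtain ⟨q, hq, -⟩ := h.1 p hp
      simp at hq
    simpa using ih h.2

theorem IsCliqueWord.exists_getLast {A : List (V × ℤ)} (hA : IsCliqueWord Γ A) {p : V × ℤ}
    (hp : p ∈ A) : ∃ D, IsCentralWord Γ D ∧ D.getLast? = some p ∧ evalWord Γ D = evalWord Γ A := by
  obtain ⟨s, t, rfl⟩ := List.append_of_mem hp
  have hperm : (s ++ p :: t).Perm (s ++ t ++ [p]) :=
    List.perm_middle.trans (List.perm_append_singleton _ _).symm
  exact ⟨s ++ t ++ [p], (hA.perm hperm).isCentralWord (by simp), by simp,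
    (hA.evalWord_perm hperm).symm⟩

theorem exists_central_form_of_isChain_blocks (L : List (List (V × ℤ))) :
    ∀ A : List (V × ℤ), A ≠ [] → (∀ B ∈ A :: L, IsCliqueWord Γ B) →
      (A :: L).IsChain (Blocks Γ) →
    ∃ (D : List (V × ℤ)) (M : List (List (V × ℤ))) (p : V × ℤ), p ∈ A ∧ D.getLast? = some p ∧
      (∀ B ∈ D :: M, IsCentralWord Γ B) ∧ (D :: M).IsChain (LastLettersNonCommuting Γ) ∧
      ((D :: M).map (evalWord Γ)).prod = ((A :: L).map (evalWord Γ)).prod := by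
  induction L with
  | nil =>
    intro A hA hc _
    obtain ⟨p, hp⟩ := List.exists_mem_of_ne_nil A hA
    obtain ⟨D, hD, hlast, heval⟩ := (hc A (by simp)).exists_getLast hp
    exact ⟨D, [], p, hp, hlast, by simpa using hD, by simp, by simp [heval]⟩
  | cons C L ih =>
    intro A hA hc hchain
    rw [List.isChain_cons_cons] at hchain
    rw [List.forall_mem_cons] at hc
    by_cases hC : C = []
    · subst hC
      obtain ⟨p, hp⟩ := List.exists_mem_of_ne_nil A hA
      obtain ⟨D, hD, hlast, heval⟩ := hc.1.exists_getLast hp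
      exact ⟨D, [], p, hp, hlast, by simpa using hD, by simp,
        by simp [heval, prod_eq_one_of_isChain_blocks_nil L hchain.2]⟩
    · obtain ⟨E, M, p, hp, hE, hcent, hM, hprod⟩ := ih C hC hc.2 hchain.2
      obtain ⟨q, hq, hqp⟩ := hchain.1 p hp
      obtain ⟨D, hD, hlast, heval⟩ := hc.1.exists_getLast hq
      refine ⟨D, E :: M, q, hq, hlast, List.forall_mem_cons.2 ⟨hD, hcent⟩,
        List.isChain_cons_cons.2 ⟨⟨q, p, hlast, hE, hqp⟩, hM⟩, ?_⟩
      rw [List.map_cons, List.prod_cons, hprod, heval, List.map_cons (l := C :: L),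
        List.prod_cons]

theorem exists_prod_cliqueWords (g : RAAG Γ) : ∃ L : List (List (V × ℤ)),
    (∀ B ∈ L, IsCliqueWord Γ B) ∧ (L.map (evalWord Γ)).prod = g := by
  obtain ⟨w, rfl⟩ := PresentedGroup.mk_surjective (raagRels Γ) g
  induction w using FreeGroup.induction_on with
  | C1 => exact ⟨[], by simp⟩
  | of a => exact ⟨[[(a, 1)]], by simp [IsCliqueWord], by simp [PresentedGroup.of]⟩
  | inv_of a _ => exact ⟨[[(a, -1)]], by simp [IsCliqueWord], by simp [PresentedGroup.of]⟩
  | mul x y hx hy =>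
    obtain ⟨L, hL, hLx⟩ := hx
    obtain ⟨M, hM, hMy⟩ := hy
    exact ⟨L ++ M, List.forall_mem_append.2 ⟨hL, hM⟩, by simp [hLx, hMy]⟩

end

/-- Every nonidentity element of a right-angled Artin group can be written in central
form: a product `W_n ⋯ W_1` of central words in which the last letters of consecutive
blocks do not commute. -/
theorem stmt_9 {V : Type*} [Fintype V] (Γ : SimpleGraph V) (g : RAAG Γ) (hg : g ≠ 1) :
    ∃ blocks : List (List (V × ℤ)), blocks ≠ [] ∧
      (∀ B ∈ blocks, IsCentralWord Γ B) ∧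
      List.Chain' (LastLettersNonCommuting Γ) blocks ∧
      g = (blocks.map (evalWord Γ)).prod := by
  obtain ⟨L, hL, rfl⟩ := exists_prod_cliqueWords g
  obtain ⟨M, -, -, hM, hchain, hprod⟩ := exists_isChain_blocks _ L le_rfl hL
  rw [← hprod] at hg ⊢
  rcases M with _ | ⟨A, M⟩
  · simp at hg
  by_cases hA : A = []
  · subst hA
    simp [prod_eq_one_of_isChain_blocks_nil M hchain] at hg
  · obtain ⟨D, N, -, -, -, hcent, hN, heq⟩ :=
      exists_central_form_of_isChain_blocks M A hA hM hchain
    exact ⟨D :: N, by simp, hcent, hN, heq.symm⟩
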